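/- For any δ > 0, any Borel probability measure P on ℝ^d, and every z ∈ ℝ^d, the distributionally robust halfspace depth is strictly positive: D_δ(z|P) > 0. -/

import Mathlib

open MeasureTheory RealInnerProductSpace
open scoped ENNReal

abbrev Ed (d : ℕ) := EuclideanSpace ℝ (Fin d)

/-- 1-Wasserstein distance between Borel measures on `ℝ^d`. -/
noncomputable def wassersteinDist {d : ℕ} (P Q : Measure (Ed d)) : ℝ≥0∞ :=
  ⨅ (π : Measure (Ed d × Ed d)) (_ : π.map Prod.fst = P) (_ : π.map Prod.snd = Q),
    ∫⁻ p, ENNReal.ofReal ‖p.1 - p.2‖ ∂π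

/-- Worst-case probability of a set over the Wasserstein ball of radius `δ` around `P`. -/
noncomputable def supProb {d : ℕ} (δ : ℝ) (P : Measure (Ed d)) (A : Set (Ed d)) : ℝ :=
  sSup {v : ℝ | ∃ Q : Measure (Ed d), IsProbabilityMeasure Q ∧
    wassersteinDist Q P ≤ ENNReal.ofReal δ ∧ v = (Q A).toReal}

/-- Distributionally robust halfspace depth. -/
noncomputable def robustDepth {d : ℕ} (δ : ℝ) (z : Ed d) (P : Measure (Ed d)) : ℝ :=
  sInf {v : ℝ | ∃ u : Ed d, ‖u‖ = 1 ∧ v = supProb δ P {x | 0 ≤ ⟪u, x - z⟫}}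

theorem exists_ball_measure_ne_zero {X : Type*} [PseudoMetricSpace X] [MeasurableSpace X]
    (P : Measure X) [NeZero P] (z : X) : ∃ R : ℝ, 0 < R ∧ P (Metric.ball z R) ≠ 0 := by
  by_contra! h
  refine NeZero.ne P (Measure.measure_univ_eq_zero.1 ?_)
  rw [← Metric.iUnion_ball_nat z]
  refine measure_iUnion_null fun n => ?_
  exact measure_mono_null (Metric.ball_subset_ball (by linarith)) (h (n + 1 : ℝ) (by positivity))

theorem le_supProb {d : ℕ} {δ : ℝ} {P Q : Measure (Ed d)} [IsProbabilityMeasure Q]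
    (hQ : wassersteinDist Q P ≤ ENNReal.ofReal δ) (A : Set (Ed d)) :
    Q.real A ≤ supProb δ P A := by
  refine le_csSup ⟨1, ?_⟩ ⟨Q, inferInstance, hQ, rfl⟩
  rintro _ ⟨Q', _, -, rfl⟩
  exact measureReal_le_one

/-- Moving a fraction `b` of `P` along `f` costs at most `b * R` when `f` displaces points by at
most `R`. -/
theorem wassersteinDist_mixture_map_le {d : ℕ} (P : Measure (Ed d)) [IsProbabilityMeasure P]
    {f : Ed d → Ed d} (hf : Measurable f) {R : ℝ} (hR : ∀ x, ‖f x - x‖ ≤ R)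
    {a b : ℝ≥0∞} (hab : a + b = 1) :
    wassersteinDist (a • P + b • P.map f) P ≤ b * ENNReal.ofReal R := by
  have hd : Measurable fun x : Ed d => (x, x) := by fun_prop
  have hg : Measurable fun x : Ed d => (f x, x) := by fun_prop
  have hc : Measurable fun p : Ed d × Ed d => ENNReal.ofReal ‖p.1 - p.2‖ := by fun_prop
  refine (iInf₂_le (a • P.map (fun x => (x, x)) + b • P.map (fun x => (f x, x))) ?_).trans
    ((iInf_le _ ?_).trans ?_)
  · rw [Measure.map_add _ _ measurable_fst, Measure.map_smul, Measure.map_smul,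
      Measure.map_map measurable_fst hd, Measure.map_map measurable_fst hg]
    simp [Function.comp_def]
  · rw [Measure.map_add _ _ measurable_snd, Measure.map_smul, Measure.map_smul,
      Measure.map_map measurable_snd hd, Measure.map_map measurable_snd hg]
    simp [Function.comp_def, ← add_smul, hab]
  · rw [lintegral_add_measure, lintegral_smul_measure, lintegral_smul_measure,
      lintegral_map hc hd, lintegral_map hc hg]
    simp only [sub_self, norm_zero, ENNReal.ofReal_zero, lintegral_zero, smul_eq_mul, mul_zero,
      zero_add]
    gcongr
    calc ∫⁻ x, ENNReal.ofReal ‖f x - x‖ ∂P ≤ ∫⁻ _, ENNReal.ofReal R ∂P :=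
          lintegral_mono fun x => ENNReal.ofReal_le_ofReal (hR x)
      _ = ENNReal.ofReal R := by simp

/-- Every Wasserstein ball of positive radius contains a measure with an atom at `z`. -/
theorem exists_wassersteinDist_le_singleton_pos {d : ℕ} {δ : ℝ} (hδ : 0 < δ)
    (P : Measure (Ed d)) [IsProbabilityMeasure P] (z : Ed d) :
    ∃ Q : Measure (Ed d), IsProbabilityMeasure Q ∧
      wassersteinDist Q P ≤ ENNReal.ofReal δ ∧ 0 < Q.real {z} := by
  classical
  obtain ⟨R, hR, hPR⟩ := exists_ball_measure_ne_zero P z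
  set t : ℝ := min 1 (δ / R)
  have ht0 : 0 < t := by positivity
  have ht1 : t ≤ 1 := min_le_left _ _
  let f : Ed d → Ed d := (Metric.ball z R).piecewise (fun _ => z) id
  have hf : Measurable f := Measurable.piecewise measurableSet_ball measurable_const measurable_id
  have hfR : ∀ x, ‖f x - x‖ ≤ R := fun x => by
    by_cases hx : x ∈ Metric.ball z R
    · simpa [f, hx, ← dist_eq_norm, dist_comm] using (Metric.mem_ball.1 hx).le
    · simpa [f, hx] using hR.le
  have hab : ENNReal.ofReal (1 - t) + ENNReal.ofReal t = 1 := by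
    rw [← ENNReal.ofReal_add (by linarith) ht0.le]; simp
  have := Measure.isProbabilityMeasure_map (μ := P) hf.aemeasurable
  have hQ : IsProbabilityMeasure (ENNReal.ofReal (1 - t) • P + ENNReal.ofReal t • P.map f) :=
    ⟨by simpa using hab⟩
  refine ⟨_, hQ, (wassersteinDist_mixture_map_le P hf hfR hab).trans ?_, ?_⟩
  · rw [← ENNReal.ofReal_mul ht0.le]
    exact ENNReal.ofReal_le_ofReal ((le_div_iff₀ hR).1 (min_le_right _ _))
  · refine ENNReal.toReal_pos (fun h => ?_) (measure_ne_top _ _)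
    simp only [Measure.coe_add, Measure.coe_smul, Pi.add_apply, Pi.smul_apply, smul_eq_mul,
      add_eq_zero, mul_eq_zero, ENNReal.ofReal_eq_zero, not_le.2 ht0, false_or,
      Measure.map_apply hf (measurableSet_singleton z)] at h
    exact hPR (measure_mono_null (fun x hx => by simp [f, hx]) h.2)

/-- **Positivity (P4).** For every `z ∈ ℝ^d` (`d ≥ 1`) and `δ > 0`, `D_δ(z|P) > 0`. -/
theorem robustDepth_pos {d : ℕ} (hd : 0 < d) (δ : ℝ) (hδ : 0 < δ)
    (P : Measure (Ed d)) [IsProbabilityMeasure P] (z : Ed d) :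
    0 < robustDepth δ z P := by
  obtain ⟨Q, _, hQP, hQz⟩ := exists_wassersteinDist_le_singleton_pos hδ P z
  refine hQz.trans_le (le_csInf ?_ ?_)
  · exact ⟨_, EuclideanSpace.single ⟨0, hd⟩ 1, by simp, rfl⟩
  · rintro _ ⟨u, -, rfl⟩
    exact (measureReal_mono (by simp)).trans (le_supProb hQP _)
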